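/- Let μ > 1, α ∈ ℝ, λ ∈ ℂ. Suppose w': ℝ² → ℂ² is smooth and satisfies, for all ξ' ≠ 0, the eigenvalue equation λ w' = Δ'w' + (ξ'/2)·∇'w' + w' − (1 + (μ+2)/(2(μ−1))) w' − α (u^G·∇') w' + α (w'·∇') u^G. Then for all ξ' ≠ 0: (i) the scalar function h = ξ'·w' satisfies λ h = Δ'h + (ξ'/2)·∇'h + h − 2 ∇'·w' − (1/2) h − (1 + (μ+2)/(2(μ−1))) h − α (u^G·∇') h; and (ii) the scalar function f = ∇'·w' satisfies λ f = Δ'f + (ξ'/2)·∇'f + f + (1/2) f − (1 + (μ+2)/(2(μ−1))) f − α (u^G·∇') f. -/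

import Mathlib

noncomputable section

/-- Partial derivative in the `i`-th coordinate direction of a real scalar function on `ℝ²`. -/
def pd2 (i : Fin 2) (f : (Fin 2 → ℝ) → ℝ) (ξ : Fin 2 → ℝ) : ℝ :=
  fderiv ℝ f ξ (Pi.single i 1)

/-- Partial derivative in the `i`-th coordinate direction of a complex scalar function on `ℝ²`. -/
def pdc (i : Fin 2) (f : (Fin 2 → ℝ) → ℂ) (ξ : Fin 2 → ℝ) : ℂ :=
  fderiv ℝ f ξ (Pi.single i 1)

/-- The two-dimensional Oseen vortex velocity profile
`u^G(ξ') = ((1 - e^{-|ξ'|²/4})/(2π|ξ'|²)) (-ξ₂, ξ₁)`. -/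
def uG2 (ξ : Fin 2 → ℝ) : Fin 2 → ℝ :=
  ((1 - Real.exp (-(ξ 0 ^ 2 + ξ 1 ^ 2) / 4)) / (2 * Real.pi * (ξ 0 ^ 2 + ξ 1 ^ 2))) •
    ![-(ξ 1), ξ 0]

/-- `ξ'·w'` for a complex vector field `w'` on `ℝ²`. -/
def dotXi (w : (Fin 2 → ℝ) → Fin 2 → ℂ) (ξ : Fin 2 → ℝ) : ℂ :=
  (ξ 0 : ℂ) * w ξ 0 + (ξ 1 : ℂ) * w ξ 1

/-- `∇'·w'` for a complex vector field `w'` on `ℝ²`. -/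
def divW (w : (Fin 2 → ℝ) → Fin 2 → ℂ) (ξ : Fin 2 → ℝ) : ℂ :=
  pdc 0 (fun ζ => w ζ 0) ξ + pdc 1 (fun ζ => w ζ 1) ξ

open scoped ContDiff

section PartialDerivative

variable {i j : Fin 2} {f g : (Fin 2 → ℝ) → ℂ} {ξ : Fin 2 → ℝ}

lemma pdc_add (hf : DifferentiableAt ℝ f ξ) (hg : DifferentiableAt ℝ g ξ) :
    pdc i (fun η => f η + g η) ξ = pdc i f ξ + pdc i g ξ := by
  simp [pdc, fderiv_fun_add hf hg]

lemma pdc_sub (hf : DifferentiableAt ℝ f ξ) (hg : DifferentiableAt ℝ g ξ) :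
    pdc i (fun η => f η - g η) ξ = pdc i f ξ - pdc i g ξ := by
  simp [pdc, fderiv_fun_sub hf hg]

lemma pdc_mul (hf : DifferentiableAt ℝ f ξ) (hg : DifferentiableAt ℝ g ξ) :
    pdc i (fun η => f η * g η) ξ = f ξ * pdc i g ξ + g ξ * pdc i f ξ := by
  simp [pdc, fderiv_fun_mul hf hg]

lemma pdc_const (c : ℂ) : pdc i (fun _ => c) ξ = 0 := by
  simp [pdc]

lemma differentiable_ofReal_coord (j : Fin 2) :
    Differentiable ℝ (fun η : Fin 2 → ℝ => (η j : ℂ)) :=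
  Complex.ofRealCLM.differentiable.comp (differentiable_apply j)

lemma pdc_ofReal {u : (Fin 2 → ℝ) → ℝ} (hu : DifferentiableAt ℝ u ξ) :
    pdc i (fun η => (u η : ℂ)) ξ = (pd2 i u ξ : ℂ) := by
  have h := (Complex.ofRealCLM.hasFDerivAt.comp ξ hu.hasFDerivAt).fderiv
  simp only [pdc, pd2]
  exact congrArg (fun L : (Fin 2 → ℝ) →L[ℝ] ℂ => L (Pi.single i 1)) h

lemma pdc_coord : pdc i (fun η => (η j : ℂ)) ξ = if j = i then 1 else 0 := by
  have h : HasFDerivAt (fun η : Fin 2 → ℝ => η j)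
      (ContinuousLinearMap.proj (R := ℝ) (φ := fun _ : Fin 2 => ℝ) j) ξ :=
    hasFDerivAt_apply j ξ
  rw [pdc_ofReal h.differentiableAt, pd2, h.fderiv]
  simp [Pi.single_apply, apply_ite]

lemma ContDiffAt.pdc (hf : ContDiffAt ℝ ∞ f ξ) (i : Fin 2) : ContDiffAt ℝ ∞ (pdc i f) ξ :=
  (hf.fderiv_right (m := ∞) (by simp)).clm_apply contDiffAt_const

lemma ContDiff.pdc (hf : ContDiff ℝ ∞ f) (i : Fin 2) : ContDiff ℝ ∞ (pdc i f) :=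
  contDiff_iff_contDiffAt.2 fun _ => hf.contDiffAt.pdc i

lemma pdc_pdc (hf : ContDiffAt ℝ ∞ f ξ) (i j : Fin 2) :
    pdc i (pdc j f) ξ = fderiv ℝ (fderiv ℝ f) ξ (Pi.single i 1) (Pi.single j 1) := by
  have h : DifferentiableAt ℝ (fderiv ℝ f) ξ :=
    (hf.fderiv_right (m := ∞) (by simp)).differentiableAt (by simp)
  have e := fderiv_clm_apply h (differentiableAt_const (Pi.single j (1 : ℝ) : Fin 2 → ℝ))
  change fderiv ℝ (fun η => fderiv ℝ f η (Pi.single j 1)) ξ _ = _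
  rw [e]
  simp

lemma pdc_comm (hf : ContDiffAt ℝ ∞ f ξ) (i j : Fin 2) :
    pdc i (pdc j f) ξ = pdc j (pdc i f) ξ := by
  rw [pdc_pdc hf, pdc_pdc hf]
  exact hf.isSymmSndFDerivAt (by
    simpa using (WithTop.coe_le_coe.2 le_top : ((2 : ℕ∞) : WithTop ℕ∞) ≤ ∞)) _ _

lemma pdc_congr (h : f =ᶠ[nhds ξ] g) : pdc i f ξ = pdc i g ξ := by
  rw [pdc, pdc, h.fderiv_eq]

end PartialDerivative

section OseenVortex

variable {ξ : Fin 2 → ℝ}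

lemma sq_add_sq_ne_zero (hξ : ξ ≠ 0) : ξ 0 ^ 2 + ξ 1 ^ 2 ≠ 0 := by
  contrapose! hξ
  have h0 : ξ 0 = 0 := by nlinarith [sq_nonneg (ξ 0), sq_nonneg (ξ 1)]
  have h1 : ξ 1 = 0 := by nlinarith [sq_nonneg (ξ 0), sq_nonneg (ξ 1)]
  ext i
  fin_cases i <;> simp [h0, h1]

lemma contDiffAt_uG2 (hξ : ξ ≠ 0) (i : Fin 2) : ContDiffAt ℝ ∞ (fun η => uG2 η i) ξ := by
  have h := sq_add_sq_ne_zero hξ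
  have hne : 2 * Real.pi * (ξ 0 ^ 2 + ξ 1 ^ 2) ≠ 0 := by positivity
  have hg : ContDiffAt ℝ ∞ (fun η : Fin 2 → ℝ =>
      (1 - Real.exp (-(η 0 ^ 2 + η 1 ^ 2) / 4)) / (2 * Real.pi * (η 0 ^ 2 + η 1 ^ 2))) ξ := by
    refine ContDiffAt.div ?_ ?_ hne <;> fun_prop
  fin_cases i
  · simpa [uG2] using hg.mul (by fun_prop : ContDiffAt ℝ ∞ (fun η : Fin 2 → ℝ => -(η 1)) ξ)
  · simpa [uG2] using hg.mul (by fun_prop : ContDiffAt ℝ ∞ (fun η : Fin 2 → ℝ => η 0) ξ)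

lemma div_uG2_eq_zero (hξ : ξ ≠ 0) :
    pd2 0 (fun η => uG2 η 0) ξ + pd2 1 (fun η => uG2 η 1) ξ = 0 := by
  have h := sq_add_sq_ne_zero hξ
  have hφ : DifferentiableAt ℝ (fun s : ℝ => (1 - Real.exp (-s / 4)) / (2 * Real.pi * s))
      (ξ 0 ^ 2 + ξ 1 ^ 2) := by
    refine DifferentiableAt.div ?_ ?_ (by positivity) <;> fun_prop
  have p : ∀ j : Fin 2, HasFDerivAt (fun η : Fin 2 → ℝ => η j)
      (ContinuousLinearMap.proj (R := ℝ) (φ := fun _ : Fin 2 => ℝ) j) ξ :=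
    fun j => hasFDerivAt_apply j ξ
  have hg := hφ.hasDerivAt.comp_hasFDerivAt ξ (((p 0).pow 2).add ((p 1).pow 2))
  have e0 := (hg.mul (p 1).neg).fderiv
  have e1 := (hg.mul (p 0)).fderiv
  have c0 : pd2 0 (fun η => uG2 η 0) ξ = _ := congrArg (fun L => L (Pi.single 0 1)) e0
  have c1 : pd2 1 (fun η => uG2 η 1) ξ = _ := congrArg (fun L => L (Pi.single 1 1)) e1
  rw [c0, c1]
  simp
  ring

lemma inner_uG2_eq_zero (ξ : Fin 2 → ℝ) : ξ 0 * uG2 ξ 0 + ξ 1 * uG2 ξ 1 = 0 := by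
  simp [uG2]
  ring

end OseenVortex

/-- If `w'` satisfies the eigenvalue equation
`λw' = Δ'w' + (ξ'/2)·∇'w' + w' - (1 + (μ+2)/(2(μ-1)))w' - α(u^G·∇')w' + α(w'·∇')u^G`
for all `ξ' ≠ 0`, then `ξ'·w'` and `∇'·w'` satisfy the stated scalar equations. -/
theorem eigen_equation_consequences
    (μ : ℝ) (hμ : 1 < μ) (α : ℝ) (lam : ℂ)
    (w : (Fin 2 → ℝ) → Fin 2 → ℂ) (hw : ContDiff ℝ (⊤ : ℕ∞) w)
    (heq : ∀ ξ : Fin 2 → ℝ, ξ ≠ 0 → ∀ i : Fin 2,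
      lam * w ξ i =
        (∑ j, pdc j (fun η => pdc j (fun ζ => w ζ i) η) ξ) +
          (∑ j, ((ξ j : ℂ) / 2) * pdc j (fun ζ => w ζ i) ξ) + w ξ i -
          ((1 : ℂ) + (((μ + 2) / (2 * (μ - 1)) : ℝ) : ℂ)) * w ξ i -
          (α : ℂ) * (∑ j, ((uG2 ξ j : ℝ) : ℂ) * pdc j (fun ζ => w ζ i) ξ) +
          (α : ℂ) * (∑ j, w ξ j * ((pd2 j (fun ζ => uG2 ζ i) ξ : ℝ) : ℂ))) :
    (∀ ξ : Fin 2 → ℝ, ξ ≠ 0 →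
        lam * dotXi w ξ =
          (∑ j, pdc j (fun η => pdc j (dotXi w) η) ξ) +
            (∑ j, ((ξ j : ℂ) / 2) * pdc j (dotXi w) ξ) + dotXi w ξ -
            2 * divW w ξ - (1 / 2 : ℂ) * dotXi w ξ -
            ((1 : ℂ) + (((μ + 2) / (2 * (μ - 1)) : ℝ) : ℂ)) * dotXi w ξ -
            (α : ℂ) * (∑ j, ((uG2 ξ j : ℝ) : ℂ) * pdc j (dotXi w) ξ)) ∧
      (∀ ξ : Fin 2 → ℝ, ξ ≠ 0 →
        lam * divW w ξ =
          (∑ j, pdc j (fun η => pdc j (divW w) η) ξ) +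
            (∑ j, ((ξ j : ℂ) / 2) * pdc j (divW w) ξ) + divW w ξ +
            (1 / 2 : ℂ) * divW w ξ -
            ((1 : ℂ) + (((μ + 2) / (2 * (μ - 1)) : ℝ) : ℂ)) * divW w ξ -
            (α : ℂ) * (∑ j, ((uG2 ξ j : ℝ) : ℂ) * pdc j (divW w) ξ)) := by
  have hA : ∀ i, ContDiff ℝ ∞ (fun ζ => w ζ i) := fun i => contDiff_pi.1 hw i
  have d0 : ∀ i, Differentiable ℝ (fun ζ => w ζ i) := fun i => (hA i).differentiable (by simp)
  have d1 : ∀ i j, Differentiable ℝ (pdc j (fun ζ => w ζ i)) :=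
    fun i j => ((hA i).pdc j).differentiable (by simp)
  have d2 : ∀ i j k, Differentiable ℝ (pdc k (pdc j (fun ζ => w ζ i))) :=
    fun i j k => (((hA i).pdc j).pdc k).differentiable (by simp)
  have dx := differentiable_ofReal_coord
  constructor
  · intro ξ hξ
    have hU : ∀ i, DifferentiableAt ℝ (fun η => uG2 η i) ξ :=
      fun i => (contDiffAt_uG2 hξ i).differentiableAt (by simp)
    have hUc : ∀ i, DifferentiableAt ℝ (fun η => (uG2 η i : ℂ)) ξ :=
      fun i => Complex.ofRealCLM.differentiableAt.comp ξ (hU i)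
    have hh : ∀ j, pdc j (dotXi w) = fun η =>
        ((η 0 : ℂ) * pdc j (fun ζ => w ζ 0) η + w η 0 * (if (0 : Fin 2) = j then 1 else 0)) +
        ((η 1 : ℂ) * pdc j (fun ζ => w ζ 1) η + w η 1 * (if (1 : Fin 2) = j then 1 else 0)) := by
      intro j
      funext η
      change pdc j (fun η => (η 0 : ℂ) * w η 0 + (η 1 : ℂ) * w η 1) η = _
      simp (disch := fun_prop) only [pdc_add, pdc_mul, pdc_coord]
    have horth : ∀ j, pdc j (fun η => (η 0 : ℂ) * (uG2 η 0 : ℂ) + (η 1 : ℂ) * (uG2 η 1 : ℂ)) ξ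
        = 0 := by
      intro j
      have : (fun η : Fin 2 → ℝ => (η 0 : ℂ) * (uG2 η 0 : ℂ) + (η 1 : ℂ) * (uG2 η 1 : ℂ))
          = fun _ => 0 := by
        funext η
        exact_mod_cast inner_uG2_eq_zero η
      rw [this]
      simp [pdc]
    have o0 := horth 0
    have o1 := horth 1
    simp (disch := fun_prop) only [pdc_add, pdc_mul, pdc_coord, pdc_ofReal] at o0 o1
    have E0 := heq ξ hξ 0
    have E1 := heq ξ hξ 1
    simp only [hh, Fin.sum_univ_two]
    simp (disch := fun_prop) only [pdc_add, pdc_mul, pdc_const, pdc_coord, dotXi, divW]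
    simp only [if_true, zero_ne_one, one_ne_zero, if_false] at o0 o1 ⊢
    rw [Fin.sum_univ_two, Fin.sum_univ_two, Fin.sum_univ_two, Fin.sum_univ_two] at E0 E1
    linear_combination (ξ 0 : ℂ) * E0 + (ξ 1 : ℂ) * E1 + α * (w ξ 0 * o0 + w ξ 1 * o1)
  · intro ξ hξ
    have hUs : ∀ i, ContDiffAt ℝ ∞ (fun η => (uG2 η i : ℂ)) ξ :=
      fun i => Complex.ofRealCLM.contDiff.contDiffAt.comp ξ (contDiffAt_uG2 hξ i)
    have hU : ∀ i, DifferentiableAt ℝ (fun η => (uG2 η i : ℂ)) ξ :=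
      fun i => (hUs i).differentiableAt (by simp)
    have hU1 : ∀ i j, DifferentiableAt ℝ (pdc j (fun η => (uG2 η i : ℂ))) ξ :=
      fun i j => ((hUs i).pdc j).differentiableAt (by simp)
    have hnear : ∀ᶠ η in nhds ξ, η ≠ 0 := isOpen_ne.mem_nhds hξ
    have key : ∀ i, pdc i (fun η => lam * w η i) ξ = pdc i (fun η =>
        (pdc 0 (pdc 0 (fun ζ => w ζ i)) η + pdc 1 (pdc 1 (fun ζ => w ζ i)) η) +
          (((1 / 2 : ℂ) * (η 0 : ℂ)) * pdc 0 (fun ζ => w ζ i) η +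
            ((1 / 2 : ℂ) * (η 1 : ℂ)) * pdc 1 (fun ζ => w ζ i) η) + w η i -
          ((1 : ℂ) + (((μ + 2) / (2 * (μ - 1)) : ℝ) : ℂ)) * w η i -
          (α : ℂ) * ((uG2 η 0 : ℂ) * pdc 0 (fun ζ => w ζ i) η +
            (uG2 η 1 : ℂ) * pdc 1 (fun ζ => w ζ i) η) +
          (α : ℂ) * (w η 0 * pdc 0 (fun ζ => (uG2 ζ i : ℂ)) η +
            w η 1 * pdc 1 (fun ζ => (uG2 ζ i : ℂ)) η)) ξ := by
      refine fun i => pdc_congr (hnear.mono fun η hη => ?_)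
      have hd := (contDiffAt_uG2 hη i).differentiableAt (by simp)
      simp only [heq η hη i, Fin.sum_univ_two, pdc_ofReal hd]
      ring
    have hdiv : pdc 0 (fun η => (uG2 η 0 : ℂ)) =ᶠ[nhds ξ]
        fun η => (-1 : ℂ) * pdc 1 (fun η => (uG2 η 1 : ℂ)) η := by
      refine hnear.mono fun η hη => ?_
      have hd := fun i => (contDiffAt_uG2 hη i).differentiableAt (by simp)
      have h := div_uG2_eq_zero hη
      simp only [pdc_ofReal (hd _)]
      rw [eq_neg_of_add_eq_zero_left h]
      simp
    have v0 := pdc_congr (i := 0) hdiv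
    have v1 := pdc_congr (i := 1) hdiv
    have hf : ∀ j, pdc j (divW w) = fun η =>
        pdc j (pdc 0 (fun ζ => w ζ 0)) η + pdc j (pdc 1 (fun ζ => w ζ 1)) η := by
      intro j
      funext η
      exact pdc_add (d1 0 0 η) (d1 1 1 η)
    have cw : ∀ i, pdc 1 (pdc 0 (fun ζ => w ζ i)) = pdc 0 (pdc 1 (fun ζ => w ζ i)) :=
      fun i => funext fun η => pdc_comm (hA i).contDiffAt 1 0
    have cw' : ∀ i j, pdc 1 (pdc 0 (pdc j (fun ζ => w ζ i))) =
        pdc 0 (pdc 1 (pdc j (fun ζ => w ζ i))) :=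
      fun i j => funext fun η => pdc_comm ((hA i).pdc j).contDiffAt 1 0
    have k0 := key 0
    have k1 := key 1
    simp (disch := fun_prop) only [pdc_add, pdc_sub, pdc_mul, pdc_const, pdc_coord,
      pdc_comm (hUs _) 1 0, cw, cw'] at k0 k1 v0 v1
    simp only [hf, Fin.sum_univ_two]
    simp (disch := fun_prop) only [pdc_add, cw, cw', divW]
    simp only [if_true, zero_ne_one, one_ne_zero, if_false] at k0 k1 ⊢
    linear_combination k0 + k1 + α * (w ξ 0 * v0 + w ξ 1 * v1)

end
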